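/- On ℝ² with the Euclidean cometric g, the Poisson bivector Π ∂₁∧∂₂ and the associated contravariant Levi-Civita connection D with curvature R, a smooth 1-form η is a 2-Killing 1-form (L_η(L_η g) = 0) if and only if g(R(α,η)η, α) = g(D_αη, D_αη) + g(D_αD_ηη, α) for every smooth 1-form α. -/

import Mathlib

noncomputable section

/-- Smooth scalar functions on `ℝ²`. -/
abbrev Fn : Type := (ℝ × ℝ) → ℝ

/-- A 1-form on `ℝ²` identified with its pair of component functions. -/
abbrev OneForm : Type := Fn × Fn

/-- Partial derivative in the first coordinate direction. -/
def pd1 (f : Fn) : Fn := fun p => fderiv ℝ f p (1, 0)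

/-- Partial derivative in the second coordinate direction. -/
def pd2 (f : Fn) : Fn := fun p => fderiv ℝ f p (0, 1)

/-- Smoothness of a function. -/
def SmoothFn (f : Fn) : Prop := ContDiff ℝ (⊤ : ℕ∞) f

/-- Smoothness of a 1-form. -/
def SmoothForm (ω : OneForm) : Prop := SmoothFn ω.1 ∧ SmoothFn ω.2

/-- The Euclidean cometric on 1-forms. -/
def gmet (ω τ : OneForm) : Fn := fun p => ω.1 p * τ.1 p + ω.2 p * τ.2 p

/-- The sharp map `♯(ω)` acting on a function. -/
def sharpF (Pi : Fn) (ω : OneForm) (f : Fn) : Fn :=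
  fun p => Pi p * (ω.1 p * pd2 f p - ω.2 p * pd1 f p)

/-- The contravariant Levi-Civita connection associated with `(g, Π)`. -/
def Dconn (Pi : Fn) (ω τ : OneForm) : OneForm :=
  (fun p => sharpF Pi ω τ.1 p + (ω.1 p * pd1 Pi p + ω.2 p * pd2 Pi p) * τ.2 p,
   fun p => sharpF Pi ω τ.2 p - (ω.1 p * pd1 Pi p + ω.2 p * pd2 Pi p) * τ.1 p)

/-- The sharp map as a vector field `(X¹, X²)`. -/
def sharpVF (Pi : Fn) (ω : OneForm) : Fn × Fn :=
  (fun p => -(Pi p) * ω.2 p, fun p => Pi p * ω.1 p)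

/-- Lie derivative of a 1-form along a vector field. -/
def lieVF (X : Fn × Fn) (τ : OneForm) : OneForm :=
  (fun p => X.1 p * pd1 τ.1 p + X.2 p * pd2 τ.1 p + τ.1 p * pd1 X.1 p + τ.2 p * pd1 X.2 p,
   fun p => X.1 p * pd1 τ.2 p + X.2 p * pd2 τ.2 p + τ.1 p * pd2 X.1 p + τ.2 p * pd2 X.2 p)

/-- The bivector evaluated on two 1-forms: `Π(ω,τ) = Π·(ω₁τ₂ − ω₂τ₁)`. -/
def PiForm (Pi : Fn) (ω τ : OneForm) : Fn :=
  fun p => Pi p * (ω.1 p * τ.2 p - ω.2 p * τ.1 p)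

/-- The exterior differential of a function, as a 1-form. -/
def dF (f : Fn) : OneForm := (pd1 f, pd2 f)

/-- The Koszul bracket of 1-forms. -/
def koszul (Pi : Fn) (ω τ : OneForm) : OneForm :=
  lieVF (sharpVF Pi ω) τ - lieVF (sharpVF Pi τ) ω - dF (PiForm Pi ω τ)

/-- Lie derivative of the cometric `g` along a 1-form `η`. -/
def lieG (Pi : Fn) (η α β : OneForm) : Fn :=
  fun p => sharpF Pi η (gmet α β) p - gmet (koszul Pi η α) β p - gmet α (koszul Pi η β) p

/-- Second Lie derivative `(L_η (L_η g))(α, β)`. -/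
def lie2G (Pi : Fn) (η α β : OneForm) : Fn :=
  fun p => sharpF Pi η (lieG Pi η α β) p - lieG Pi η (koszul Pi η α) β p
    - lieG Pi η α (koszul Pi η β) p

/-- `η` is a Killing 1-form. -/
def IsKilling (Pi : Fn) (η : OneForm) : Prop :=
  ∀ α β : OneForm, SmoothForm α → SmoothForm β → lieG Pi η α β = 0

/-- `η` is a 2-Killing 1-form. -/
def Is2Killing (Pi : Fn) (η : OneForm) : Prop :=
  ∀ α β : OneForm, SmoothForm α → SmoothForm β → lie2G Pi η α β = 0

/-- Curvature of the contravariant connection. -/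
def curv (Pi : Fn) (ω τ γ : OneForm) : OneForm :=
  Dconn Pi ω (Dconn Pi τ γ) - Dconn Pi τ (Dconn Pi ω γ) - Dconn Pi (koszul Pi ω τ) γ

/-- The coordinate 1-form `dx¹`. -/
def dx1 : OneForm := (fun _ => 1, fun _ => 0)

/-- The coordinate 1-form `dx²`. -/
def dx2 : OneForm := (fun _ => 0, fun _ => 1)

/-- Contravariant Laplacian on functions. -/
def lapF (Pi : Fn) (f : Fn) : Fn :=
  fun p => -((sharpF Pi dx1 (sharpF Pi dx1 f) p - sharpF Pi (Dconn Pi dx1 dx1) f p)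
    + (sharpF Pi dx2 (sharpF Pi dx2 f) p - sharpF Pi (Dconn Pi dx2 dx2) f p))

/-- Contravariant Laplacian on 1-forms. -/
def lapO (Pi : Fn) (η : OneForm) : OneForm :=
  -((Dconn Pi dx1 (Dconn Pi dx1 η) - Dconn Pi (Dconn Pi dx1 dx1) η)
    + (Dconn Pi dx2 (Dconn Pi dx2 η) - Dconn Pi (Dconn Pi dx2 dx2) η))

section PartialDerivatives

variable {f g : Fn}

lemma SmoothFn.differentiableAt (hf : SmoothFn f) (p : ℝ × ℝ) : DifferentiableAt ℝ f p :=
  (ContDiff.differentiable hf (by simp)) p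

lemma SmoothFn.add (hf : SmoothFn f) (hg : SmoothFn g) : SmoothFn (fun p => f p + g p) :=
  ContDiff.add hf hg

lemma SmoothFn.sub (hf : SmoothFn f) (hg : SmoothFn g) : SmoothFn (fun p => f p - g p) :=
  ContDiff.sub hf hg

lemma SmoothFn.mul (hf : SmoothFn f) (hg : SmoothFn g) : SmoothFn (fun p => f p * g p) :=
  ContDiff.mul hf hg

lemma SmoothFn.neg (hf : SmoothFn f) : SmoothFn (fun p => -f p) :=
  ContDiff.neg hf

lemma SmoothFn.pd1 (hf : SmoothFn f) : SmoothFn (pd1 f) :=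
  (ContDiff.fderiv_right hf (m := (⊤ : ℕ∞)) (by simp)).clm_apply contDiff_const

lemma SmoothFn.pd2 (hf : SmoothFn f) : SmoothFn (pd2 f) :=
  (ContDiff.fderiv_right hf (m := (⊤ : ℕ∞)) (by simp)).clm_apply contDiff_const

lemma pd1_add (hf : SmoothFn f) (hg : SmoothFn g) (p : ℝ × ℝ) :
    pd1 (fun p => f p + g p) p = pd1 f p + pd1 g p := by
  simp [pd1, fderiv_fun_add (hf.differentiableAt p) (hg.differentiableAt p)]

lemma pd2_add (hf : SmoothFn f) (hg : SmoothFn g) (p : ℝ × ℝ) :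
    pd2 (fun p => f p + g p) p = pd2 f p + pd2 g p := by
  simp [pd2, fderiv_fun_add (hf.differentiableAt p) (hg.differentiableAt p)]

lemma pd1_sub (hf : SmoothFn f) (hg : SmoothFn g) (p : ℝ × ℝ) :
    pd1 (fun p => f p - g p) p = pd1 f p - pd1 g p := by
  simp [pd1, fderiv_fun_sub (hf.differentiableAt p) (hg.differentiableAt p)]

lemma pd2_sub (hf : SmoothFn f) (hg : SmoothFn g) (p : ℝ × ℝ) :
    pd2 (fun p => f p - g p) p = pd2 f p - pd2 g p := by
  simp [pd2, fderiv_fun_sub (hf.differentiableAt p) (hg.differentiableAt p)]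

lemma pd1_mul (hf : SmoothFn f) (hg : SmoothFn g) (p : ℝ × ℝ) :
    pd1 (fun p => f p * g p) p = f p * pd1 g p + g p * pd1 f p := by
  simp [pd1, fderiv_fun_mul (hf.differentiableAt p) (hg.differentiableAt p)]

lemma pd2_mul (hf : SmoothFn f) (hg : SmoothFn g) (p : ℝ × ℝ) :
    pd2 (fun p => f p * g p) p = f p * pd2 g p + g p * pd2 f p := by
  simp [pd2, fderiv_fun_mul (hf.differentiableAt p) (hg.differentiableAt p)]

lemma pd1_neg (f : Fn) (p : ℝ × ℝ) : pd1 (fun p => -f p) p = -pd1 f p := by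
  simp [pd1, fderiv_fun_neg]

lemma pd2_neg (f : Fn) (p : ℝ × ℝ) : pd2 (fun p => -f p) p = -pd2 f p := by
  simp [pd2, fderiv_fun_neg]

end PartialDerivatives

section Connection

variable {Pi f g : Fn} {ω τ σ : OneForm}

lemma SmoothForm.add (hω : SmoothForm ω) (hτ : SmoothForm τ) : SmoothForm (ω + τ) :=
  ⟨hω.1.add hτ.1, hω.2.add hτ.2⟩

lemma SmoothForm.sub (hω : SmoothForm ω) (hτ : SmoothForm τ) : SmoothForm (ω - τ) :=
  ⟨hω.1.sub hτ.1, hω.2.sub hτ.2⟩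

lemma SmoothForm.gmet (hω : SmoothForm ω) (hτ : SmoothForm τ) : SmoothFn (gmet ω τ) :=
  (hω.1.mul hτ.1).add (hω.2.mul hτ.2)

lemma SmoothFn.sharpF (hPi : SmoothFn Pi) (hω : SmoothForm ω) (hf : SmoothFn f) :
    SmoothFn (sharpF Pi ω f) :=
  hPi.mul ((hω.1.mul hf.pd2).sub (hω.2.mul hf.pd1))

lemma SmoothForm.Dconn (hPi : SmoothFn Pi) (hω : SmoothForm ω) (hτ : SmoothForm τ) :
    SmoothForm (Dconn Pi ω τ) :=
  have h := (hω.1.mul hPi.pd1).add (hω.2.mul hPi.pd2)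
  ⟨(hPi.sharpF hω hτ.1).add (h.mul hτ.2), (hPi.sharpF hω hτ.2).sub (h.mul hτ.1)⟩

lemma gmet_def (ω τ : OneForm) : gmet ω τ = fun p => ω.1 p * τ.1 p + ω.2 p * τ.2 p := rfl

lemma PiForm_def (Pi : Fn) (ω τ : OneForm) :
    PiForm Pi ω τ = fun p => Pi p * (ω.1 p * τ.2 p - ω.2 p * τ.1 p) := rfl

lemma gmet_add_left (ω τ σ : OneForm) : gmet (ω + τ) σ = gmet ω σ + gmet τ σ := by
  funext p; simp [gmet]; ring

lemma gmet_sub_left (ω τ σ : OneForm) : gmet (ω - τ) σ = gmet ω σ - gmet τ σ := by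
  funext p; simp [gmet]; ring

lemma gmet_comm (ω τ : OneForm) : gmet ω τ = gmet τ ω := by
  funext p; simp [gmet]; ring

lemma gmet_add_right (ω τ σ : OneForm) : gmet ω (τ + σ) = gmet ω τ + gmet ω σ := by
  funext p; simp [gmet]; ring

lemma gmet_sub_right (ω τ σ : OneForm) : gmet ω (τ - σ) = gmet ω τ - gmet ω σ := by
  funext p; simp [gmet]; ring

lemma sharpF_add (Pi : Fn) (ω : OneForm) (hf : SmoothFn f) (hg : SmoothFn g) :
    sharpF Pi ω (f + g) = sharpF Pi ω f + sharpF Pi ω g := by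
  funext p
  simp only [sharpF, _root_.Pi.add_def, pd1_add hf hg, pd2_add hf hg]
  ring

/-- The connection is compatible with the cometric. -/
lemma sharpF_gmet (Pi : Fn) (ω : OneForm) (hτ : SmoothForm τ) (hσ : SmoothForm σ) :
    sharpF Pi ω (gmet τ σ) = gmet (Dconn Pi ω τ) σ + gmet τ (Dconn Pi ω σ) := by
  funext p
  simp only [sharpF, gmet_def, Dconn, _root_.Pi.add_apply,
    pd1_add (hτ.1.mul hσ.1) (hτ.2.mul hσ.2), pd2_add (hτ.1.mul hσ.1) (hτ.2.mul hσ.2),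
    pd1_mul hτ.1 hσ.1, pd2_mul hτ.1 hσ.1, pd1_mul hτ.2 hσ.2, pd2_mul hτ.2 hσ.2]
  ring

/-- The connection is torsion-free. -/
lemma koszul_eq_Dconn_sub (hPi : SmoothFn Pi) (hω : SmoothForm ω) (hτ : SmoothForm τ) :
    koszul Pi ω τ = Dconn Pi ω τ - Dconn Pi τ ω := by
  have h := (hω.1.mul hτ.2).sub (hω.2.mul hτ.1)
  ext p <;>
  · simp only [koszul, lieVF, sharpVF, dF, PiForm_def, Dconn, sharpF, Prod.fst_sub, Prod.snd_sub,
      _root_.Pi.sub_apply, pd1_mul hPi h, pd2_mul hPi h,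
      pd1_sub (hω.1.mul hτ.2) (hω.2.mul hτ.1), pd2_sub (hω.1.mul hτ.2) (hω.2.mul hτ.1),
      pd1_mul hω.1 hτ.2, pd2_mul hω.1 hτ.2, pd1_mul hω.2 hτ.1, pd2_mul hω.2 hτ.1,
      pd1_mul hPi.neg hω.2, pd2_mul hPi.neg hω.2, pd1_mul hPi.neg hτ.2, pd2_mul hPi.neg hτ.2,
      pd1_mul hPi hω.1, pd2_mul hPi hω.1, pd1_mul hPi hτ.1, pd2_mul hPi hτ.1,
      pd1_neg, pd2_neg]
    ring

lemma SmoothForm.koszul (hPi : SmoothFn Pi) (hω : SmoothForm ω) (hτ : SmoothForm τ) :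
    SmoothForm (koszul Pi ω τ) := by
  rw [koszul_eq_Dconn_sub hPi hω hτ]
  exact (hω.Dconn hPi hτ).sub (hτ.Dconn hPi hω)

lemma Dconn_add_left (Pi : Fn) (ω τ σ : OneForm) :
    Dconn Pi (ω + τ) σ = Dconn Pi ω σ + Dconn Pi τ σ := by
  ext p <;> simp [Dconn, sharpF] <;> ring

lemma Dconn_sub_left (Pi : Fn) (ω τ σ : OneForm) :
    Dconn Pi (ω - τ) σ = Dconn Pi ω σ - Dconn Pi τ σ := by
  ext p <;> simp [Dconn, sharpF] <;> ring

lemma Dconn_add_right (Pi : Fn) (ω : OneForm) (hτ : SmoothForm τ) (hσ : SmoothForm σ) :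
    Dconn Pi ω (τ + σ) = Dconn Pi ω τ + Dconn Pi ω σ := by
  ext p <;>
  · simp only [Dconn, sharpF, Prod.fst_add, Prod.snd_add, _root_.Pi.add_def, pd1_add hτ.1 hσ.1,
      pd2_add hτ.1 hσ.1, pd1_add hτ.2 hσ.2, pd2_add hτ.2 hσ.2]
    ring

end Connection

section LieDerivative

variable {Pi : Fn} {η α β : OneForm}

lemma lieG_eq (hPi : SmoothFn Pi) (hη : SmoothForm η) (hα : SmoothForm α) (hβ : SmoothForm β) :
    lieG Pi η α β = gmet (Dconn Pi α η) β + gmet α (Dconn Pi β η) := by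
  funext p
  simp only [lieG, sharpF_gmet Pi η hα hβ, koszul_eq_Dconn_sub hPi hη hα,
    koszul_eq_Dconn_sub hPi hη hβ, gmet_sub_left, gmet_sub_right, _root_.Pi.add_apply, _root_.Pi.sub_apply]
  ring

/-- The endomorphism `α ↦ D_η D_α η - D_{[η, α]} η` of the space of 1-forms. -/
def secondDeriv (Pi : Fn) (η α : OneForm) : OneForm :=
  Dconn Pi η (Dconn Pi α η) - Dconn Pi (koszul Pi η α) η

lemma secondDeriv_add (hPi : SmoothFn Pi) (hη : SmoothForm η) (hα : SmoothForm α)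
    (hβ : SmoothForm β) :
    secondDeriv Pi η (α + β) = secondDeriv Pi η α + secondDeriv Pi η β := by
  simp only [secondDeriv, koszul_eq_Dconn_sub hPi hη (hα.add hβ), koszul_eq_Dconn_sub hPi hη hα,
    koszul_eq_Dconn_sub hPi hη hβ, Dconn_sub_left, Dconn_add_left, Dconn_add_right Pi η hα hβ,
    Dconn_add_right Pi η (hα.Dconn hPi hη) (hβ.Dconn hPi hη)]
  abel

lemma lie2G_eq (hPi : SmoothFn Pi) (hη : SmoothForm η) (hα : SmoothForm α) (hβ : SmoothForm β) :
    lie2G Pi η α β = gmet (secondDeriv Pi η α) β + gmet α (secondDeriv Pi η β)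
      + 2 * gmet (Dconn Pi α η) (Dconn Pi β η) := by
  have hDα := hα.Dconn hPi hη
  have hDβ := hβ.Dconn hPi hη
  funext p
  simp only [lie2G, secondDeriv, lieG_eq hPi hη hα hβ, lieG_eq hPi hη (hη.koszul hPi hα) hβ,
    lieG_eq hPi hη hα (hη.koszul hPi hβ), sharpF_add Pi η (hDα.gmet hβ) (hα.gmet hDβ),
    sharpF_gmet Pi η hDα hβ, sharpF_gmet Pi η hα hDβ, gmet_sub_left, gmet_sub_right,
    _root_.Pi.add_apply, _root_.Pi.sub_apply, _root_.Pi.mul_apply, _root_.Pi.ofNat_apply]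
  simp only [koszul_eq_Dconn_sub hPi hη hα, koszul_eq_Dconn_sub hPi hη hβ, gmet_sub_left,
    gmet_sub_right, _root_.Pi.sub_apply]
  ring

lemma curv_eq (hPi : SmoothFn Pi) (hη : SmoothForm η) (hα : SmoothForm α) :
    curv Pi α η η = Dconn Pi α (Dconn Pi η η) - secondDeriv Pi η α := by
  simp only [curv, secondDeriv, koszul_eq_Dconn_sub hPi hη hα, koszul_eq_Dconn_sub hPi hα hη,
    Dconn_sub_left]
  abel

lemma curv_identity_iff (hPi : SmoothFn Pi) (hη : SmoothForm η) (hα : SmoothForm α) :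
    gmet (curv Pi α η η) α
        = gmet (Dconn Pi α η) (Dconn Pi α η) + gmet (Dconn Pi α (Dconn Pi η η)) α
      ↔ gmet (secondDeriv Pi η α) α + gmet (Dconn Pi α η) (Dconn Pi α η) = 0 := by
  rw [curv_eq hPi hη hα, gmet_sub_left]
  constructor <;> intro h <;> linear_combination -h

end LieDerivative

theorem two_killing_one_form_iff (Pi : Fn) (hPi : SmoothFn Pi)
    (η : OneForm) (hη : SmoothForm η) :
    Is2Killing Pi η ↔ ∀ α : OneForm, SmoothForm α →
      gmet (curv Pi α η η) α
        = gmet (Dconn Pi α η) (Dconn Pi α η) + gmet (Dconn Pi α (Dconn Pi η η)) α := by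
  constructor
  · intro h α hα
    have hd := h α α hα hα
    rw [lie2G_eq hPi hη hα hα, gmet_comm α] at hd
    rw [curv_identity_iff hPi hη hα]
    funext p
    have hp := congrFun hd p
    simp only [_root_.Pi.add_apply, _root_.Pi.mul_apply, _root_.Pi.ofNat_apply] at hp ⊢
    linarith
  · intro h
    have hdiag : ∀ α, SmoothForm α →
        gmet (secondDeriv Pi η α) α + gmet (Dconn Pi α η) (Dconn Pi α η) = 0 :=
      fun α hα => (curv_identity_iff hPi hη hα).1 (h α hα)
    intro α β hα hβ
    have hsum := hdiag _ (hα.add hβ)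
    simp only [secondDeriv_add hPi hη hα hβ, Dconn_add_left, gmet_add_left, gmet_add_right] at hsum
    rw [gmet_comm (Dconn Pi β η) (Dconn Pi α η), gmet_comm (secondDeriv Pi η β) α] at hsum
    rw [lie2G_eq hPi hη hα hβ]
    linear_combination hsum - hdiag α hα - hdiag β hβ

end
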